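/- arXiv:2008.11543 — 2 statements merged into one kernel-verified Lean document; each statement's English description precedes it below -/
import Mathlib

section
/- Let T be a finite tree. For every integer k, the limb numbers satisfy ℓ_1(T) ≥ ℓ_k(T). -/
/-- The limb number `ℓ_k(T)`: the number of pairs `(v, T')` where `v` is a vertex of `T`
and `T'` is a connected component (given by its vertex set) with exactly `k` vertices
of the forest `T ∖ v` obtained by deleting `v` from `T`. -/
noncomputable def limbNumber {V : Type*} [Fintype V] (G : SimpleGraph V) (k : ℤ) : ℕ :=
  Set.ncard {p : V × Set V |
    (∃ c : (G.induce ({p.1}ᶜ : Set V)).ConnectedComponent, p.2 = Subtype.val '' c.supp)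
    ∧ (p.2.ncard : ℤ) = k}

namespace SimpleGraph

variable {V : Type*} {G : SimpleGraph V}

/-- The vertices on the side of `w` once the edge `vw` is deleted. -/
def branch (G : SimpleGraph V) (v w : V) : Set V :=
  {u | (G.deleteEdges {s(v, w)}).Reachable w u}

lemma mem_branch_self (v w : V) : w ∈ G.branch v w := Reachable.refl _

lemma Adj.reachable_deleteEdges {a b : V} (h : G.Adj a b) {e : Sym2 V} (he : s(a, b) ≠ e) :
    (G.deleteEdges {e}).Reachable a b :=
  Adj.reachable (by simpa [deleteEdges_adj] using ⟨h, he⟩)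

/-- A component of `G - e` missing the vertex `x` remains connected when an edge at `x` is deleted
instead of `e`. -/
lemma Reachable.deleteEdges_of_not_reachable {e : Sym2 V} {a b x : V} (y : V)
    (hab : (G.deleteEdges {e}).Reachable a b) (hax : ¬ (G.deleteEdges {e}).Reachable a x) :
    (G.deleteEdges {s(x, y)}).Reachable a b := by
  obtain ⟨p⟩ := hab
  induction p with
  | nil => exact Reachable.refl _
  | @cons a c b h p ih =>
    have hcx : ¬ (G.deleteEdges {e}).Reachable c x := fun hc => hax (h.reachable.trans hc)
    refine Reachable.trans ?_ (ih hcx)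
    refine Adj.reachable_deleteEdges (deleteEdges_adj.1 h).1 fun heq => ?_
    rcases Sym2.eq_iff.1 heq with ⟨rfl, -⟩ | ⟨-, rfl⟩
    · exact hax (Reachable.refl _)
    · exact hcx (Reachable.refl _)

lemma IsAcyclic.not_reachable_deleteEdges (hG : G.IsAcyclic) {v w : V} (h : G.Adj v w) :
    ¬ (G.deleteEdges {s(v, w)}).Reachable v w := by
  have hb := isAcyclic_iff_forall_adj_isBridge.1 hG h
  exact isBridge_iff.1 hb

lemma Connected.reachable_deleteEdges_or (hG : G.Connected) (v w a : V) :
    (G.deleteEdges {s(v, w)}).Reachable v a ∨ (G.deleteEdges {s(v, w)}).Reachable w a := by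
  obtain ⟨p⟩ := hG.preconnected a v
  induction p with
  | nil => exact Or.inl (Reachable.refl _)
  | @cons a b v h p ih =>
    by_cases he : s(a, b) = s(v, w)
    · rcases Sym2.eq_iff.1 he with ⟨rfl, -⟩ | ⟨rfl, -⟩
      · exact Or.inl (Reachable.refl _)
      · exact Or.inr (Reachable.refl _)
    · have hr := (h.reachable_deleteEdges he).symm
      exact ih.imp (·.trans hr) (·.trans hr)

lemma IsTree.compl_branch (hG : G.IsTree) {v w : V} (h : G.Adj v w) :
    (G.branch v w)ᶜ = G.branch w v := by
  ext a
  have hn := hG.isAcyclic.not_reachable_deleteEdges h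
  simp only [branch, Set.mem_compl_iff, Set.mem_ofPred_eq, Sym2.eq_swap (a := w) (b := v)]
  constructor
  · intro ha
    exact (hG.connected.reachable_deleteEdges_or v w a).resolve_right ha
  · intro hv hw
    exact hn (hv.trans hw.symm)

/-- Every branch of a finite tree contains a leaf. -/
lemma IsTree.exists_branch_eq_singleton [Finite V] (hG : G.IsTree) {v w : V} (h : G.Adj v w) :
    ∃ p u, G.Adj p u ∧ G.branch p u = {u} ∧ u ∈ G.branch v w := by
  induction hn : (G.branch v w).ncard using Nat.strong_induction_on generalizing v w with
  | _ n ih =>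
  by_cases hs : G.branch v w = {w}
  · exact ⟨v, w, h, hs, mem_branch_self v w⟩
  obtain ⟨a, ha, haw⟩ : ∃ a ∈ G.branch v w, a ≠ w := by
    by_contra! hc
    exact hs (Set.Subset.antisymm hc (Set.singleton_subset_iff.2 (mem_branch_self v w)))
  obtain ⟨z, hz⟩ : ∃ z, (G.deleteEdges {s(v, w)}).Adj w z := by
    obtain ⟨p⟩ : (G.deleteEdges {s(v, w)}).Reachable w a := ha
    cases p with
    | nil => exact absurd rfl haw
    | cons h _ => exact ⟨_, h⟩
  have hwz : G.Adj w z := (deleteEdges_adj.1 hz).1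
  have hnr := hG.isAcyclic.not_reachable_deleteEdges hwz
  have hsub : G.branch w z ⊆ G.branch v w := by
    intro b hb
    have hb' := Reachable.deleteEdges_of_not_reachable v hb (fun hc => hnr hc.symm)
    rw [Sym2.eq_swap] at hb'
    exact hz.reachable.trans hb'
  have hlt : (G.branch w z).ncard < (G.branch v w).ncard :=
    Set.ncard_lt_ncard ⟨hsub, fun hc => hnr (Reachable.symm (hc (mem_branch_self v w)))⟩
  obtain ⟨p, u, hpu, hsing, hu⟩ := ih _ (hn ▸ hlt) hwz rfl
  exact ⟨p, u, hpu, hsing, hsub hu⟩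

/-- Intersecting branches of equal size at most `|V| / 2` come from the same directed edge. -/
lemma IsTree.eq_of_mem_branch [Finite V] (hG : G.IsTree) {v w x y u : V} (hvw : G.Adj v w)
    (hxy : G.Adj x y) (hcard : (G.branch v w).ncard = (G.branch x y).ncard)
    (hle : 2 * (G.branch v w).ncard ≤ Nat.card V)
    (hu : u ∈ G.branch v w) (hu' : u ∈ G.branch x y) : v = x ∧ w = y := by
  have hn := hG.isAcyclic.not_reachable_deleteEdges hvw
  have hn' := hG.isAcyclic.not_reachable_deleteEdges hxy
  by_cases he : s(v, w) = s(x, y)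
  · rcases Sym2.eq_iff.1 he with h | ⟨rfl, rfl⟩
    · exact h
    · rw [← hG.compl_branch hvw] at hu'
      exact absurd hu hu'
  exfalso
  have rxy := hxy.reachable_deleteEdges (Ne.symm he)
  have rvw := hvw.reachable_deleteEdges he
  rcases hG.connected.reachable_deleteEdges_or v w x with hx | hx
  · have key : ∀ a ∈ G.branch v w, (G.deleteEdges {s(x, y)}).Reachable w a := fun a ha =>
      Reachable.deleteEdges_of_not_reachable y ha fun hc => hn (hx.trans hc.symm)
    rcases hG.connected.reachable_deleteEdges_or x y w with hw | hw
    · exact hn' ((hw.trans (key u hu)).trans (Reachable.symm hu'))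
    · have hsub : G.branch v w ⊆ G.branch x y := fun a ha => hw.trans (key a ha)
      have heq := Set.eq_of_subset_of_ncard_le hsub hcard.ge
      have hy : y ∈ G.branch v w := heq ▸ mem_branch_self x y
      exact hn ((hx.trans rxy).trans (Reachable.symm hy))
  · have key : ∀ a ∈ (G.branch v w)ᶜ, (G.deleteEdges {s(x, y)}).Reachable w a := fun a ha => by
      have ha' := (hG.connected.reachable_deleteEdges_or v w a).resolve_right ha
      exact rvw.symm.trans
        (Reachable.deleteEdges_of_not_reachable y ha' fun hc => hn (hc.trans hx.symm))
    rcases hG.connected.reachable_deleteEdges_or x y w with hw | hw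
    · have hsub : G.branch x y ⊆ G.branch v w := fun a ha => by
        by_contra hc
        exact hn' ((hw.trans (key a hc)).trans (Reachable.symm ha))
      have heq := Set.eq_of_subset_of_ncard_le hsub hcard.le
      have hw' : w ∈ G.branch x y := heq ▸ mem_branch_self v w
      exact hn' (hw.trans (Reachable.symm hw'))
    · have hun : G.branch v w ∪ G.branch x y = Set.univ := by
        refine Set.eq_univ_of_forall fun a => ?_
        by_cases ha : a ∈ G.branch v w
        · exact Or.inl ha
        · exact Or.inr (hw.trans (key a ha))
      have h1 := Set.ncard_union_add_ncard_inter (G.branch v w) (G.branch x y)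
      have h2 : 0 < (G.branch v w ∩ G.branch x y).ncard :=
        (Set.ncard_pos).2 ⟨u, hu, hu'⟩
      rw [hun, Set.ncard_univ] at h1
      omega

lemma Reachable.induce_compl_singleton {e : Sym2 V} {a b v : V}
    (hab : (G.deleteEdges {e}).Reachable a b) (hav : ¬ (G.deleteEdges {e}).Reachable a v)
    (ha : a ∈ ({v}ᶜ : Set V)) :
    ∃ hb : b ∈ ({v}ᶜ : Set V), (G.induce ({v}ᶜ : Set V)).Reachable ⟨a, ha⟩ ⟨b, hb⟩ := by
  obtain ⟨p⟩ := hab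
  induction p with
  | nil => exact ⟨ha, Reachable.refl _⟩
  | @cons a c b h p ih =>
    have hcv : ¬ (G.deleteEdges {e}).Reachable c v := fun hc => hav (h.reachable.trans hc)
    have hc : c ∈ ({v}ᶜ : Set V) := by
      rintro rfl
      exact hcv (Reachable.refl _)
    obtain ⟨hb, hr⟩ := ih hcv hc
    have hadj : (G.induce ({v}ᶜ : Set V)).Adj ⟨a, ha⟩ ⟨c, hc⟩ := (deleteEdges_adj.1 h).1
    exact ⟨hb, hadj.reachable.trans hr⟩

lemma IsAcyclic.image_supp_eq_branch (hG : G.IsAcyclic) {v w : V} (h : G.Adj v w)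
    (hw : w ∈ ({v}ᶜ : Set V)) :
    Subtype.val '' ((G.induce ({v}ᶜ : Set V)).connectedComponentMk ⟨w, hw⟩).supp
      = G.branch v w := by
  ext a
  constructor
  · rintro ⟨⟨a, ha⟩, hc, rfl⟩
    have hr : (G.induce ({v}ᶜ : Set V)).Reachable ⟨w, hw⟩ ⟨a, ha⟩ :=
      (ConnectedComponent.exact hc).symm
    let f : G.induce ({v}ᶜ : Set V) →g G.deleteEdges {s(v, w)} :=
      { toFun := Subtype.val
        map_rel' := by
          rintro ⟨b, hb⟩ ⟨c, hc⟩ hbc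
          refine deleteEdges_adj.2 ⟨hbc, fun he => ?_⟩
          rcases Sym2.eq_iff.1 he with ⟨hbv, -⟩ | ⟨-, hcv⟩
          · exact hb hbv
          · exact hc hcv }
    exact hr.map f
  · intro ha
    obtain ⟨ha', hr⟩ := Reachable.induce_compl_singleton ha
      (fun hc => hG.not_reachable_deleteEdges h hc.symm) hw
    exact ⟨⟨a, ha'⟩, ConnectedComponent.sound hr.symm, rfl⟩

lemma Connected.exists_adj_reachable_induce (hG : G.Connected) {v a : V}
    (ha : a ∈ ({v}ᶜ : Set V)) :
    ∃ (w : V) (hw : w ∈ ({v}ᶜ : Set V)), G.Adj v w ∧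
      (G.induce ({v}ᶜ : Set V)).Reachable ⟨a, ha⟩ ⟨w, hw⟩ := by
  obtain ⟨p⟩ := hG.preconnected a v
  induction p with
  | nil => exact absurd rfl ha
  | @cons a b v h p ih =>
    by_cases hb : b = v
    · subst hb
      exact ⟨a, ha, h.symm, Reachable.refl _⟩
    · obtain ⟨w, hw, hvw, hr⟩ := ih hb
      have hadj : (G.induce ({v}ᶜ : Set V)).Adj ⟨a, ha⟩ ⟨b, hb⟩ := h
      exact ⟨w, hw, hvw, hadj.reachable.trans hr⟩

/-- The components of `G - v` are the branches at the edges `vw`. -/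
lemma IsTree.exists_component_iff (hG : G.IsTree) (v : V) (S : Set V) :
    (∃ c : (G.induce ({v}ᶜ : Set V)).ConnectedComponent, S = Subtype.val '' c.supp)
      ↔ ∃ w, G.Adj v w ∧ S = G.branch v w := by
  constructor
  · rintro ⟨c, rfl⟩
    induction c using ConnectedComponent.ind with
    | _ a =>
    obtain ⟨w, hw, hvw, hr⟩ := hG.connected.exists_adj_reachable_induce a.2
    refine ⟨w, hvw, ?_⟩
    rw [← hG.isAcyclic.image_supp_eq_branch hvw hw, ConnectedComponent.sound hr]
  · rintro ⟨w, hvw, rfl⟩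
    exact ⟨_, (hG.isAcyclic.image_supp_eq_branch hvw hvw.ne').symm⟩

lemma IsTree.limbNumber_le [Fintype V] (hG : G.IsTree) (k : ℕ) :
    limbNumber G k ≤ {d : V × V | G.Adj d.1 d.2 ∧ (G.branch d.1 d.2).ncard = k}.ncard := by
  refine (Set.ncard_le_ncard ?_ (Set.toFinite _)).trans
    (Set.ncard_image_le (f := fun d : V × V => (d.1, G.branch d.1 d.2)) (Set.toFinite _))
  rintro ⟨v, S⟩ ⟨hc, hk⟩
  obtain ⟨w, hvw, rfl⟩ := (hG.exists_component_iff v S).1 hc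
  exact ⟨(v, w), ⟨hvw, by exact_mod_cast hk⟩, rfl⟩

lemma IsTree.ncard_le_limbNumber_one [Fintype V] (hG : G.IsTree) {k : ℕ}
    (hk : 2 * k ≤ Nat.card V) :
    {d : V × V | G.Adj d.1 d.2 ∧ (G.branch d.1 d.2).ncard = k}.ncard ≤ limbNumber G 1 := by
  have hleaf : ∀ d : V × V, ∃ q : V × V, G.Adj d.1 d.2 →
      G.Adj q.1 q.2 ∧ G.branch q.1 q.2 = {q.2} ∧ q.2 ∈ G.branch d.1 d.2 := by
    intro d
    by_cases h : G.Adj d.1 d.2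
    · obtain ⟨p, u, hpu⟩ := hG.exists_branch_eq_singleton h
      exact ⟨(p, u), fun _ => hpu⟩
    · exact ⟨d, fun h' => absurd h' h⟩
  choose f hf using hleaf
  refine Set.ncard_le_ncard_of_injOn (fun d => ((f d).1, {(f d).2})) ?_ ?_ (Set.toFinite _)
  · rintro d ⟨hd, -⟩
    obtain ⟨hadj, hsing, -⟩ := hf d hd
    exact ⟨(hG.exists_component_iff _ _).2 ⟨_, hadj, hsing.symm⟩, by simp⟩
  · rintro d ⟨hd, hdk⟩ d' ⟨hd', hdk'⟩ heq
    have hu : (f d).2 = (f d').2 := Set.singleton_injective (Prod.ext_iff.1 heq).2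
    obtain ⟨h1, h2⟩ := hG.eq_of_mem_branch hd hd' (hdk.trans hdk'.symm) (hdk ▸ hk)
      (hf d hd).2.2 (hu ▸ (hf d' hd').2.2)
    exact Prod.ext h1 h2

lemma IsTree.ncard_branch_le_swap [Finite V] (hG : G.IsTree) (k : ℕ) :
    {d : V × V | G.Adj d.1 d.2 ∧ (G.branch d.1 d.2).ncard = k}.ncard ≤
      {d : V × V | G.Adj d.1 d.2 ∧ (G.branch d.1 d.2).ncard = Nat.card V - k}.ncard := by
  refine Set.ncard_le_ncard_of_injOn Prod.swap ?_ Prod.swap_injective.injOn (Set.toFinite _)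
  rintro ⟨v, w⟩ ⟨h, hk⟩
  refine ⟨h.symm, ?_⟩
  change (G.branch w v).ncard = _
  rw [← hG.compl_branch h, Set.ncard_compl]
  exact congrArg _ hk

end SimpleGraph

theorem stmt_3 {V : Type*} [Fintype V] (G : SimpleGraph V) (hG : G.IsTree) (k : ℤ) :
    limbNumber G k ≤ limbNumber G 1 := by
  rcases Int.lt_or_le k 0 with hk | hk
  · have hempty : limbNumber G k = 0 := by
      rw [limbNumber, Set.ncard_eq_zero (Set.toFinite _)]
      refine Set.eq_empty_of_forall_notMem ?_
      rintro p ⟨-, hp⟩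
      omega
    omega
  lift k to ℕ using hk
  refine (hG.limbNumber_le k).trans ?_
  rcases le_total (2 * k) (Nat.card V) with h | h
  · exact hG.ncard_le_limbNumber_one h
  · exact (hG.ncard_branch_le_swap k).trans (hG.ncard_le_limbNumber_one (by omega))
end

section
/- Let G be a finite tree with vertex set V, where |V| = n ≥ 1. Suppose P and Q each assign a real number to every nonempty subset S ⊆ V whose induced subgraph is connected (hence a subtree of G), satisfying for every such S: P(S) = max over v ∈ S of [1/|S| + (1/|S|)·Σ_C |C|·Q(C)] and Q(S) = (1/|S|²)·Σ_{v ∈ S} Σ_C |C|·P(C), where C ranges over the vertex sets of the connected components of the subgraph of G induced on S ∖ {v}. Then P(V) ≤ 2/3 − 1/(3n) + (2/(3n))·(binom(n−1, (n−1)/2)/2^{n−1})·[n odd] and Q(V) ≤ 2/3 − 2/(3n) + (2/(3n))·(binom(n, n/2)/2^n)·[n even], i.e., the star graph maximizes both win probabilities among trees on n vertices. -/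
/-- Closed-form win probability for an optimally playing **first** player against a uniformly
random opponent in the tree search game on the star with `n` vertices. -/
noncomputable def starP (n : ℕ) : ℝ :=
  2 / 3 - 1 / (3 * (n : ℝ)) +
    if Odd n then (2 / (3 * (n : ℝ))) * (((n - 1).choose ((n - 1) / 2) : ℝ) / 2 ^ (n - 1))
    else 0

/-- Closed-form win probability for an optimally playing **second** player against a uniformly
random opponent in the tree search game on the star with `n` vertices. -/
noncomputable def starQ (n : ℕ) : ℝ :=
  2 / 3 - 2 / (3 * (n : ℝ)) +
    if Even n then (2 / (3 * (n : ℝ))) * ((n.choose (n / 2) : ℝ) / 2 ^ n)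
    else 0

/-- The central binomial coefficient `n.choose (n / 2)` normalised by `2 ^ n` for even `n`,
and `0` for odd `n`. -/
noncomputable def centralWeight (n : ℕ) : ℝ :=
  if Even n then (n.choose (n / 2) : ℝ) / 2 ^ n else 0

lemma centralWeight_zero : centralWeight 0 = 1 := by simp [centralWeight]

lemma centralWeight_nonneg (n : ℕ) : 0 ≤ centralWeight n := by
  unfold centralWeight
  split_ifs <;> positivity

lemma centralWeight_two_mul (k : ℕ) :
    centralWeight (2 * k) = (k.centralBinom : ℝ) / 4 ^ k := by
  simp [centralWeight, Nat.centralBinom_eq_two_mul_choose, pow_mul]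
  norm_num

lemma centralWeight_of_odd {n : ℕ} (h : Odd n) : centralWeight n = 0 := by
  simp [centralWeight, Nat.not_even_iff_odd.mpr h]

lemma add_two_mul_centralWeight (n : ℕ) :
    ((n : ℝ) + 2) * centralWeight (n + 2) = (n + 1) * centralWeight n := by
  rcases Nat.even_or_odd n with h | h
  · obtain ⟨k, rfl⟩ := even_iff_two_dvd.mp h
    have e : 2 * k + 2 = 2 * (k + 1) := by ring
    rw [e, centralWeight_two_mul, centralWeight_two_mul]
    have := Nat.succ_mul_centralBinom_succ k
    have h' : ((k : ℝ) + 1) * (k + 1).centralBinom = 2 * (2 * k + 1) * k.centralBinom := by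
      exact_mod_cast this
    push_cast
    field_simp
    rw [pow_succ]
    linear_combination (2 * 4 ^ k : ℝ) * h'
  · rw [centralWeight_of_odd h, centralWeight_of_odd (by grind)]
    simp

lemma centralWeight_le_half : ∀ n : ℕ, 1 ≤ n → centralWeight n ≤ 1 / 2
  | 0, h => by omega
  | 1, _ => by rw [centralWeight_of_odd (by decide)]; norm_num
  | 2, _ => by
    have := add_two_mul_centralWeight 0
    norm_num [centralWeight_zero] at this ⊢
    linarith
  | n + 3, _ => by
    have h := add_two_mul_centralWeight (n + 1)
    have ih := centralWeight_le_half (n + 1) (by omega)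
    have := centralWeight_nonneg (n + 1)
    push_cast at h
    have hn : (0 : ℝ) ≤ n := n.cast_nonneg
    by_contra! hc
    have hc' : 1 / 2 < centralWeight (n + 1 + 2) := hc
    nlinarith

/-- The value of `n * starP n`, for positive `n`. -/
noncomputable def scaledStarP (n : ℕ) : ℝ := 2 / 3 * n - 1 / 3 + 2 / 3 * centralWeight (n - 1)

/-- The value of `n * starQ n`, for positive `n`. -/
noncomputable def scaledStarQ (n : ℕ) : ℝ := 2 / 3 * (n - 1 + centralWeight n)

lemma mul_starP {n : ℕ} (hn : 1 ≤ n) : n * starP n = scaledStarP n := by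
  have hn' : (n : ℝ) ≠ 0 := by positivity
  have h : Even (n - 1) ↔ Odd n := by grind
  unfold starP scaledStarP centralWeight
  simp only [h]
  split_ifs
  · field_simp
  · field_simp
    ring

lemma mul_starQ {n : ℕ} (hn : 1 ≤ n) : n * starQ n = scaledStarQ n := by
  have hn' : (n : ℝ) ≠ 0 := by positivity
  unfold starQ scaledStarQ centralWeight
  split_ifs
  · field_simp
  · field_simp
    ring

lemma scaledStarQ_zero : scaledStarQ 0 = 0 := by simp [scaledStarQ, centralWeight_zero]

lemma scaledStarQ_add_le (a b : ℕ) :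
    scaledStarQ a + scaledStarQ b ≤ scaledStarQ (a + b) := by
  rcases Nat.eq_zero_or_pos a with rfl | ha
  · simp [scaledStarQ_zero]
  rcases Nat.eq_zero_or_pos b with rfl | hb
  · simp [scaledStarQ_zero]
  have h1 := centralWeight_le_half a ha
  have h2 := centralWeight_le_half b hb
  have h3 := centralWeight_nonneg (a + b)
  unfold scaledStarQ
  push_cast
  linarith

lemma sum_scaledStarQ_le {ι : Type*} (s : Finset ι) (f : ι → ℕ) :
    ∑ i ∈ s, scaledStarQ (f i) ≤ scaledStarQ (∑ i ∈ s, f i) := by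
  classical
  induction s using Finset.induction_on with
  | empty => simp [scaledStarQ_zero]
  | insert a s ha ih =>
    rw [Finset.sum_insert ha, Finset.sum_insert ha]
    linarith [scaledStarQ_add_le (f a) (∑ i ∈ s, f i)]

lemma one_add_scaledStarQ {n : ℕ} (hn : 1 ≤ n) : 1 + scaledStarQ (n - 1) = scaledStarP n := by
  obtain ⟨m, rfl⟩ := Nat.exists_eq_add_of_le' hn
  simp only [scaledStarP, scaledStarQ, Nat.add_sub_cancel]
  push_cast
  ring

lemma scaledStarP_add_le {a b : ℕ} (ha : 1 ≤ a) (hb : 1 ≤ b) :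
    scaledStarP a + scaledStarP b ≤
      2 / 3 * ((a + b : ℕ) : ℝ) + 2 / 3 * centralWeight (a + b - 2) := by
  have key : centralWeight (a - 1) + centralWeight (b - 1) ≤
      1 + centralWeight (a + b - 2) := by
    obtain rfl | ha' := ha.eq_or_lt
    · rw [show 1 + b - 2 = b - 1 by omega]
      simp [centralWeight_zero]
    obtain rfl | hb' := hb.eq_or_lt
    · rw [show a + 1 - 2 = a - 1 by omega]
      simp [centralWeight_zero, add_comm]
    have h1 := centralWeight_le_half (a - 1) (by omega)
    have h2 := centralWeight_le_half (b - 1) (by omega)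
    have h3 := centralWeight_nonneg (a + b - 2)
    linarith
  unfold scaledStarP
  push_cast
  linarith

lemma sub_one_mul_le_mul_scaledStarQ {n : ℕ} (hn : 1 ≤ n) :
    ((n : ℝ) - 1) * (2 / 3 * n + 2 / 3 * centralWeight (n - 2)) ≤ n * scaledStarQ n := by
  obtain rfl | hn' := hn.eq_or_lt
  · simp [scaledStarQ, centralWeight_nonneg]
  obtain ⟨m, rfl⟩ := Nat.exists_eq_add_of_le' hn'
  have := add_two_mul_centralWeight m
  simp only [scaledStarQ, Nat.succ_eq_add_one, Nat.reduceAdd, Nat.add_sub_cancel] at *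
  push_cast
  linarith

namespace SimpleGraph

variable {V : Type*} {G : SimpleGraph V}

/-- The vertices that can be reached from `x` by a walk of `G` staying inside `T`. -/
def reachIn (G : SimpleGraph V) (T : Set V) (x : V) : Set V :=
  {y | ∃ p : G.Walk x y, ∀ z ∈ p.support, z ∈ T}

lemma reachable_induce_iff {T : Set V} (x y : T) :
    (G.induce T).Reachable x y ↔ (y : V) ∈ G.reachIn T x := by
  constructor
  · rintro ⟨p⟩
    refine ⟨p.map (Embedding.induce T).toHom, fun z hz => ?_⟩
    have hz' : z ∈ p.support.map (Embedding.induce T).toHom :=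
      Walk.support_map (Embedding.induce T).toHom p ▸ hz
    obtain ⟨w, -, rfl⟩ := List.mem_map.mp hz'
    exact w.2
  · rintro ⟨p, hp⟩
    exact ⟨p.induce T hp⟩

lemma exists_isPath_of_mem_reachIn {T : Set V} {x y : V} (h : y ∈ G.reachIn T x) :
    ∃ p : G.Walk x y, p.IsPath ∧ ∀ z ∈ p.support, z ∈ T := by
  classical
  obtain ⟨p, hp⟩ := h
  exact ⟨p.bypass, p.bypass_isPath, fun z hz => hp z (p.support_bypass_subset_support hz)⟩

lemma reachIn_subset (T : Set V) (x : V) : G.reachIn T x ⊆ T :=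
  fun _ ⟨p, hp⟩ => hp _ p.end_mem_support

lemma start_mem_of_mem_reachIn {T : Set V} {x y : V} (h : y ∈ G.reachIn T x) : x ∈ T :=
  let ⟨p, hp⟩ := h
  hp _ p.start_mem_support

lemma mem_reachIn_self {T : Set V} {x : V} (hx : x ∈ T) : x ∈ G.reachIn T x :=
  ⟨.nil, by simpa using hx⟩

lemma image_supp_connectedComponentMk {T : Set V} (x : T) :
    Subtype.val '' ((G.induce T).connectedComponentMk x).supp = G.reachIn T x := by
  ext y
  constructor
  · rintro ⟨z, hz, rfl⟩
    exact (reachable_induce_iff x z).mp (ConnectedComponent.exact hz).symm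
  · intro hy
    exact ⟨⟨y, reachIn_subset T x hy⟩,
      ConnectedComponent.sound ((reachable_induce_iff x ⟨y, _⟩).mpr hy).symm, rfl⟩

lemma connected_induce_reachIn {T : Set V} {x : V} (hx : x ∈ T) :
    (G.induce (G.reachIn T x)).Connected := by
  classical
  refine induce_connected_of_patches x (mem_reachIn_self hx) ?_
  rintro y ⟨p, hp⟩
  refine ⟨{z | z ∈ p.support}, fun z hz => ?_, p.start_mem_support, p.end_mem_support,
    p.connected_induce_support _ _⟩
  exact ⟨p.takeUntil z hz, fun w hw => hp w (p.support_takeUntil_subset_support hz hw)⟩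

lemma connected_induce_image_supp {T : Set V} (c : (G.induce T).ConnectedComponent) :
    (Subtype.val '' c.supp).Nonempty ∧ (G.induce (Subtype.val '' c.supp)).Connected := by
  induction c using ConnectedComponent.ind with
  | h x =>
    rw [image_supp_connectedComponentMk]
    exact ⟨⟨x, mem_reachIn_self x.2⟩, connected_induce_reachIn x.2⟩

lemma image_supp_subset {T : Set V} (c : (G.induce T).ConnectedComponent) :
    Subtype.val '' c.supp ⊆ T := by
  rintro _ ⟨z, -, rfl⟩
  exact z.2

lemma sum_ncard_image_supp [Finite V] (T : Set V)
    [Fintype (G.induce T).ConnectedComponent] :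
    ∑ c : (G.induce T).ConnectedComponent, (Subtype.val '' c.supp).ncard = T.ncard := by
  classical
  have := Fintype.ofFinite T
  rw [← Nat.card_coe_set_eq, Nat.card_eq_fintype_card, Fintype.card,
    Finset.card_eq_sum_card_fiberwise
      (f := (G.induce T).connectedComponentMk) (t := Finset.univ) (by simp)]
  refine Finset.sum_congr rfl fun c _ => ?_
  rw [Set.ncard_image_of_injective _ Subtype.val_injective, ← Set.ncard_coe_finset]
  congr 1
  ext z
  simp

lemma IsAcyclic.disjoint_reachIn (hG : G.IsAcyclic) {S : Set V} {u v : V} (huv : G.Adj v u) :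
    Disjoint (G.reachIn (S \ {v}) u) (G.reachIn (S \ {u}) v) := by
  rw [Set.disjoint_left]
  intro w hu hv
  obtain ⟨p, hp, hpS⟩ := exists_isPath_of_mem_reachIn hu
  obtain ⟨q, hq, hqS⟩ := exists_isPath_of_mem_reachIn hv
  have hr : (q.cons huv.symm).IsPath :=
    (Walk.cons_isPath_iff _ _).mpr ⟨hq, fun h => (hqS u h).2 rfl⟩
  have h' : p = q.cons huv.symm :=
    congrArg Subtype.val ((hG.subsingleton_path _ _).elim ⟨p, hp⟩ ⟨_, hr⟩)
  have hvp : v ∈ p.support := by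
    rw [h', Walk.support_cons]
    exact List.mem_cons_of_mem _ q.start_mem_support
  exact (hpS v hvp).2 rfl

lemma union_reachIn {S : Set V} (hS : (G.induce S).Connected) {u v : V}
    (hu : u ∈ S) (huv : G.Adj v u) :
    G.reachIn (S \ {v}) u ∪ G.reachIn (S \ {u}) v = S := by
  classical
  refine Set.Subset.antisymm (Set.union_subset ?_ ?_) fun w hw => ?_
  · exact (reachIn_subset _ _).trans Set.sdiff_subset
  · exact (reachIn_subset _ _).trans Set.sdiff_subset
  obtain ⟨p, hp, hpS⟩ := exists_isPath_of_mem_reachIn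
    ((reachable_induce_iff ⟨u, hu⟩ ⟨w, hw⟩).mp (hS.preconnected _ _))
  by_cases hv : v ∈ p.support
  · refine Or.inr ⟨p.dropUntil v hv, fun z hz => ⟨hpS z ?_, ?_⟩⟩
    · exact p.support_dropUntil_subset_support hv hz
    · rintro rfl
      have hnd : (p.takeUntil v hv).support.Disjoint (p.dropUntil v hv).support.tail := by
        have := hp.support_nodup
        rw [← p.take_spec hv, Walk.support_append, List.nodup_append'] at this
        exact this.2.2
      refine hnd (p.takeUntil v hv).start_mem_support ?_
      rw [← Walk.cons_tail_support] at hz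
      exact (List.mem_cons.mp hz).resolve_left huv.ne'
  · exact Or.inl ⟨p, fun z hz => ⟨hpS z hz, fun h => hv (h ▸ hz)⟩⟩

lemma IsAcyclic.ncard_reachIn_add [Finite V] (hG : G.IsAcyclic) {S : Set V}
    (hS : (G.induce S).Connected) {u v : V} (hu : u ∈ S) (huv : G.Adj v u) :
    (G.reachIn (S \ {v}) u).ncard + (G.reachIn (S \ {u}) v).ncard = S.ncard := by
  rw [← Set.ncard_union_eq (hG.disjoint_reachIn huv), union_reachIn hS hu huv]

lemma exists_adj_mem_reachIn {S : Set V} (hS : (G.induce S).Connected) {v w : V}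
    (hv : v ∈ S) (hw : w ∈ S) (hne : v ≠ w) :
    ∃ u, G.Adj v u ∧ w ∈ G.reachIn (S \ {v}) u := by
  obtain ⟨p, hp, hpS⟩ := exists_isPath_of_mem_reachIn
    ((reachable_induce_iff ⟨v, hv⟩ ⟨w, hw⟩).mp (hS.preconnected _ _))
  cases p with
  | nil => exact absurd rfl hne
  | @cons _ u _ h q =>
    rw [Walk.cons_isPath_iff] at hp
    exact ⟨u, h, q, fun z hz => ⟨hpS z (by simp [hz]), fun h => hp.2 (h ▸ hz)⟩⟩

open Classical in
/-- In a subtree `S`, the components of `S \ {v}` correspond to the neighbours of `v` in `S`. -/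
lemma IsAcyclic.sum_components_eq (hG : G.IsAcyclic) {S : Set V} [Fintype S]
    (hS : (G.induce S).Connected) (v : S)
    [Fintype (G.induce (S \ {(v : V)})).ConnectedComponent] (g : Set V → ℝ) :
    ∑ c : (G.induce (S \ {(v : V)})).ConnectedComponent, g (Subtype.val '' c.supp) =
      ∑ u : S, if G.Adj v u then g (G.reachIn (S \ {(v : V)}) u) else 0 := by
  rw [← Finset.sum_filter]
  symm
  have hmem : ∀ u : S, u ∈ Finset.univ.filter (fun u : S => G.Adj v u) →
      (u : V) ∈ S \ {(v : V)} :=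
    fun u hu => ⟨u.2, (Finset.mem_filter.mp hu).2.ne'⟩
  refine Finset.sum_bij (fun u hu => connectedComponentMk _ ⟨u, hmem u hu⟩)
    (fun _ _ => Finset.mem_univ _) ?_ ?_ ?_
  · intro u hu w hw h
    by_contra hne
    refine Set.disjoint_left.mp (hG.disjoint_reachIn (S := S) (Finset.mem_filter.mp hu).2)
      ((reachable_induce_iff ⟨(u : V), hmem u hu⟩ ⟨w, hmem w hw⟩).mp
        (ConnectedComponent.exact h)) ?_
    have hvw : G.Adj v w := (Finset.mem_filter.mp hw).2
    refine ⟨hvw.toWalk, fun z hz => ?_⟩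
    have hz' : z = v ∨ z = w := by simpa using hz
    rcases hz' with rfl | rfl
    · exact ⟨v.2, (Finset.mem_filter.mp hu).2.ne⟩
    · exact ⟨w.2, fun h => hne (Subtype.ext h.symm)⟩
  · intro c _
    induction c using ConnectedComponent.ind with
    | h w =>
      obtain ⟨u, hvu, hw⟩ := exists_adj_mem_reachIn hS v.2 w.2.1 (Ne.symm w.2.2)
      have hu := start_mem_of_mem_reachIn hw
      exact ⟨⟨u, hu.1⟩, by simpa using hvu,
        ConnectedComponent.sound ((reachable_induce_iff ⟨u, hu⟩ w).mpr hw)⟩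
  · intro u hu
    rw [image_supp_connectedComponentMk]

/-- Summing a function of the component sizes over all vertex deletions in a subtree with `n`
vertices: each of the `n - 1` edges contributes the sizes of its two sides. -/
lemma IsAcyclic.sum_sum_components_le [Finite V] (hG : G.IsAcyclic) {S : Set V} [Fintype S]
    (hS : (G.induce S).Connected)
    [∀ v : S, Fintype (G.induce (S \ {(v : V)})).ConnectedComponent]
    (g : ℕ → ℝ) (K : ℝ)
    (hg : ∀ a b, 1 ≤ a → 1 ≤ b → a + b = S.ncard → g a + g b ≤ K) :
    ∑ v : S, ∑ c : (G.induce (S \ {(v : V)})).ConnectedComponent,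
      g (Subtype.val '' c.supp).ncard ≤ (S.ncard - 1) * K := by
  classical
  obtain ⟨x⟩ := hS.nonempty
  have hpos : 0 < S.ncard := (Set.ncard_pos S.toFinite).mpr ⟨x, x.2⟩
  have hcard : Fintype.card S = S.ncard := by
    rw [← Nat.card_coe_set_eq, Nat.card_eq_fintype_card]
  have hsum : ∀ f : ℕ → ℝ,
      2 * ∑ v : S, ∑ c : (G.induce (S \ {(v : V)})).ConnectedComponent,
        f (Subtype.val '' c.supp).ncard =
      ∑ v : S, ∑ u : S, if G.Adj v u then
        f (G.reachIn (S \ {(v : V)}) u).ncard + f (G.reachIn (S \ {(u : V)}) v).ncard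
        else 0 := by
    intro f
    simp_rw [fun v : S => hG.sum_components_eq hS v fun C => f C.ncard]
    rw [two_mul]
    nth_rewrite 2 [Finset.sum_comm]
    simp_rw [← Finset.sum_add_distrib]
    refine Finset.sum_congr rfl fun v _ => Finset.sum_congr rfl fun u _ => ?_
    simp only [G.adj_comm u v]
    split_ifs <;> simp
  have hdarts : (∑ v : S, ∑ u : S, if G.Adj v u then (1 : ℝ) else 0) = 2 * (S.ncard - 1) := by
    have h := hsum (fun m => (m : ℝ))
    have hl : ∀ v : S, ∑ c : (G.induce (S \ {(v : V)})).ConnectedComponent,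
        ((Subtype.val '' c.supp).ncard : ℝ) = S.ncard - 1 := by
      intro v
      have := Set.ncard_sdiff_singleton_add_one v.2 S.toFinite
      rw [← Nat.cast_sum, sum_ncard_image_supp, ← this]
      simp
    have hr : ∀ v u : S, (if G.Adj v u then
        ((G.reachIn (S \ {(v : V)}) u).ncard : ℝ) + (G.reachIn (S \ {(u : V)}) v).ncard
        else 0) = S.ncard * if G.Adj v u then (1 : ℝ) else 0 := by
      intro v u
      split_ifs with huv
      · rw [mul_one, ← hG.ncard_reachIn_add hS u.2 huv, Nat.cast_add]
      · simp
    simp only [hl, hr, ← Finset.mul_sum, Finset.sum_const, Finset.card_univ, hcard,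
      nsmul_eq_mul] at h
    have : (S.ncard : ℝ) ≠ 0 := by positivity
    apply mul_left_cancel₀ this
    linarith
  suffices h : (∑ v : S, ∑ u : S, if G.Adj v u then
        g (G.reachIn (S \ {(v : V)}) u).ncard + g (G.reachIn (S \ {(u : V)}) v).ncard
        else 0) ≤ ∑ v : S, ∑ u : S, (if G.Adj v u then (1 : ℝ) else 0) * K by
    simp_rw [← Finset.sum_mul] at h
    rw [hdarts, ← hsum] at h
    linarith
  refine Finset.sum_le_sum fun v _ => Finset.sum_le_sum fun u _ => ?_
  split_ifs with huv
  · rw [one_mul]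
    refine hg _ _ ?_ ?_ (hG.ncard_reachIn_add hS u.2 huv)
    · exact (Set.ncard_pos (Set.toFinite _)).mpr ⟨u, mem_reachIn_self ⟨u.2, huv.ne'⟩⟩
    · exact (Set.ncard_pos (Set.toFinite _)).mpr ⟨v, mem_reachIn_self ⟨v.2, huv.ne⟩⟩
  · simp

end SimpleGraph

theorem stmt_14 {V : Type*} [Fintype V] (G : SimpleGraph V) (hG : G.IsTree)
    (hn : 1 ≤ Fintype.card V)
    (P Q : Set V → ℝ)
    (hP : ∀ S : Set V, S.Nonempty → (G.induce S).Connected →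
      P S = ⨆ v : S, (1 / (S.ncard : ℝ) + (1 / (S.ncard : ℝ)) *
        ∑ᶠ c : (G.induce (S \ {(v : V)})).ConnectedComponent,
          ((Subtype.val '' c.supp).ncard : ℝ) * Q (Subtype.val '' c.supp)))
    (hQ : ∀ S : Set V, S.Nonempty → (G.induce S).Connected →
      Q S = (1 / (S.ncard : ℝ) ^ 2) *
        ∑ᶠ v : S, ∑ᶠ c : (G.induce (S \ {(v : V)})).ConnectedComponent,
          ((Subtype.val '' c.supp).ncard : ℝ) * P (Subtype.val '' c.supp)) :
    P Set.univ ≤ starP (Fintype.card V) ∧ Q Set.univ ≤ starQ (Fintype.card V) := by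
  classical
  have key : ∀ n : ℕ, ∀ S : Set V, S.ncard = n → S.Nonempty → (G.induce S).Connected →
      S.ncard * P S ≤ scaledStarP S.ncard ∧ S.ncard * Q S ≤ scaledStarQ S.ncard := by
    intro n
    induction n using Nat.strong_induction_on with
    | _ n ih =>
    intro S hn hne hS
    have hpos : 1 ≤ S.ncard := (Set.ncard_pos S.toFinite).mpr hne
    have hpos' : (S.ncard : ℝ) ≠ 0 := by positivity
    have ih' : ∀ (v : S) (c : (G.induce (S \ {(v : V)})).ConnectedComponent),
        ((Subtype.val '' c.supp).ncard : ℝ) * P (Subtype.val '' c.supp) ≤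
          scaledStarP (Subtype.val '' c.supp).ncard ∧
        ((Subtype.val '' c.supp).ncard : ℝ) * Q (Subtype.val '' c.supp) ≤
          scaledStarQ (Subtype.val '' c.supp).ncard := by
      intro v c
      obtain ⟨h1, h2⟩ := SimpleGraph.connected_induce_image_supp c
      refine ih _ ?_ _ rfl h1 h2
      rw [← hn]
      refine (Set.ncard_le_ncard (SimpleGraph.image_supp_subset c) (Set.toFinite _)).trans_lt ?_
      exact Set.ncard_sdiff_singleton_lt_of_mem v.2 S.toFinite
    have : ∀ v : S, Fintype (G.induce (S \ {(v : V)})).ConnectedComponent :=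
      fun v => Fintype.ofFinite _
    constructor
    · rw [hP S hne hS, mul_comm, ← le_div_iff₀ (by positivity)]
      have := hne.to_subtype
      refine ciSup_le fun v => ?_
      rw [finsum_eq_sum_of_fintype, ← one_add_scaledStarQ hpos,
        ← Set.ncard_sdiff_singleton_of_mem v.2, ← SimpleGraph.sum_ncard_image_supp (G := G) (S \ {(v : V)})]
      have h := (Finset.sum_le_sum (s := Finset.univ) fun c _ => (ih' v c).2).trans (sum_scaledStarQ_le _ _)
      rw [le_div_iff₀ (by positivity)]
      field_simp
      linarith
    · rw [hQ S hne hS, finsum_eq_sum_of_fintype]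
      simp_rw [finsum_eq_sum_of_fintype]
      have h := (Finset.sum_le_sum fun v _ => Finset.sum_le_sum fun c _ => (ih' v c).1).trans
        (hG.isAcyclic.sum_sum_components_le hS scaledStarP
          (2 / 3 * S.ncard + 2 / 3 * centralWeight (S.ncard - 2))
          fun a b ha hb hab => hab ▸ scaledStarP_add_le ha hb)
      have h' := h.trans (sub_one_mul_le_mul_scaledStarQ hpos)
      refine le_of_mul_le_mul_left (le_of_eq_of_le ?_ h') (by positivity)
      field_simp
  have huniv : (Set.univ : Set V).ncard = Fintype.card V := by
    rw [Set.ncard_univ, Nat.card_eq_fintype_card]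
  have hne : (Set.univ : Set V).Nonempty :=
    Set.nonempty_iff_univ_nonempty.mp (Fintype.card_pos_iff.mp hn)
  have hconn : (G.induce Set.univ).Connected :=
    (SimpleGraph.induceUnivIso G).connected_iff.mpr hG.connected
  obtain ⟨hp, hq⟩ := key _ Set.univ rfl hne hconn
  rw [huniv, ← mul_starP hn] at hp
  rw [huniv, ← mul_starQ hn] at hq
  have : (0 : ℝ) < Fintype.card V := by exact_mod_cast hn
  exact ⟨le_of_mul_le_mul_left hp this, le_of_mul_le_mul_left hq this⟩
end
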